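/- Fix n ≥ 1, k ≥ 1, and a number of queries Q. For a target sequence (i_1,…,i_Q) ∈ {1,…,n}^Q, let the transcript distribution be the law of (P_1,…,P_Q) where, independently for each t, a size-k multiset H_t is drawn uniformly among size-k multisets over {1,…,n} containing i_t, and P_t is H_t with one copy of i_t removed. Then for any two target sequences (i_1,…,i_Q) and (j_1,…,j_Q), the transcript distributions are identical; both equal the Q-fold product of the uniform distribution on size-(k−1) multisets over {1,…,n}. -/

import Mathlib

open MeasureTheory

/-- The finset of all size-`k` multisets over `Fin n`. -/
noncomputable def multisetsCard (n k : ℕ) : Finset (Multiset (Fin n)) :=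
  (Finset.univ : Finset (Sym (Fin n) k)).image Sym.toMultiset

/-- `R_i`: the finset of size-`k` multisets over `Fin n` containing at least one copy of `i`. -/
noncomputable def coveringHints (n k : ℕ) (i : Fin n) : Finset (Multiset (Fin n)) :=
  (multisetsCard n k).filter (fun H => i ∈ H)

lemma multisetsCard_nonempty (n k : ℕ) (hn : 1 ≤ n) : (multisetsCard n k).Nonempty := by
  refine ⟨Multiset.replicate k ⟨0, hn⟩, ?_⟩
  simp [multisetsCard]
  exact ⟨⟨Multiset.replicate k ⟨0, hn⟩, by simp⟩, rfl⟩

lemma coveringHints_nonempty (n k : ℕ) (hk : 1 ≤ k) (i : Fin n) :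
    (coveringHints n k i).Nonempty := by
  refine ⟨Multiset.replicate k i, ?_⟩
  simp [coveringHints, multisetsCard, Multiset.mem_replicate]
  constructor
  · exact ⟨⟨Multiset.replicate k i, by simp⟩, rfl⟩
  · omega

instance (n : ℕ) : MeasurableSpace (Multiset (Fin n)) := ⊤

/-- The law of a single redacted query for target `i`: a size-`k` multiset drawn
uniformly among those containing `i`, with one copy of `i` removed. -/
noncomputable def redactedLaw (n k : ℕ) (hk : 1 ≤ k) (i : Fin n) : PMF (Multiset (Fin n)) :=
  (PMF.uniformOfFinset (coveringHints n k i) (coveringHints_nonempty n k hk i)).map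
    (fun H => H.erase i)

lemma mem_multisetsCard' (n k : ℕ) (H : Multiset (Fin n)) :
    H ∈ multisetsCard n k ↔ Multiset.card H = k := by
  simp only [multisetsCard, Finset.mem_image, Finset.mem_univ, true_and]
  constructor
  · rintro ⟨s, rfl⟩
    exact s.2
  · intro h
    exact ⟨⟨H, h⟩, rfl⟩

lemma mem_coveringHints' (n k : ℕ) (i : Fin n) (H : Multiset (Fin n)) :
    H ∈ coveringHints n k i ↔ Multiset.card H = k ∧ i ∈ H := by
  simp only [coveringHints, Finset.mem_filter, mem_multisetsCard']

lemma coveringHints_eq' (n k : ℕ) (hk : 1 ≤ k) (i : Fin n) :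
    coveringHints n k i = (multisetsCard n (k - 1)).image (fun P => i ::ₘ P) := by
  ext H
  simp only [mem_coveringHints', Finset.mem_image, mem_multisetsCard']
  constructor
  · rintro ⟨h, hi⟩
    refine ⟨H.erase i, ?_, Multiset.cons_erase hi⟩
    rw [Multiset.card_erase_of_mem hi, h]
    rfl
  · rintro ⟨P, hP, rfl⟩
    refine ⟨?_, Multiset.mem_cons_self i P⟩
    rw [Multiset.card_cons, hP]
    omega

lemma card_coveringHints' (n k : ℕ) (hk : 1 ≤ k) (i : Fin n) :
    (coveringHints n k i).card = (multisetsCard n (k - 1)).card := by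
  rw [coveringHints_eq' n k hk i]
  exact Finset.card_image_of_injective _ (fun a b h => (Multiset.cons_inj_right i).1 h)

lemma redactedLaw_eq' (n k : ℕ) (hn : 1 ≤ n) (hk : 1 ≤ k) (i : Fin n) :
    redactedLaw n k hk i = PMF.uniformOfFinset (multisetsCard n (k - 1))
      (multisetsCard_nonempty n (k - 1) hn) := by
  classical
  ext b
  rw [redactedLaw, PMF.map_apply, tsum_eq_single (i ::ₘ b)]
  · rw [if_pos (by simp), PMF.uniformOfFinset_apply, PMF.uniformOfFinset_apply,
      card_coveringHints' n k hk i]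
    have : i ::ₘ b ∈ coveringHints n k i ↔ b ∈ multisetsCard n (k - 1) := by
      rw [mem_coveringHints', mem_multisetsCard', Multiset.card_cons]
      simp only [Multiset.mem_cons_self, and_true]
      omega
    by_cases hb : b ∈ multisetsCard n (k - 1)
    · rw [if_pos (this.2 hb), if_pos hb]
    · rw [if_neg (fun h => hb (this.1 h)), if_neg hb]
  · intro a ha
    split_ifs with h
    · apply PMF.uniformOfFinset_apply_of_notMem
      intro hmem
      apply ha
      rw [h, Multiset.cons_erase ((mem_coveringHints' n k i a).1 hmem).2]
    · rfl

/-- **Multi-query transcript privacy.** For any two target sequences the transcript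
distributions (independent fresh hints each round) are identical, and both equal the
`Q`-fold product of the uniform distribution on size-`(k−1)` multisets. -/
theorem transcript_target_independent (n k Q : ℕ) (hn : 1 ≤ n) (hk : 1 ≤ k)
    (iseq jseq : Fin Q → Fin n) :
    Measure.pi (fun t : Fin Q => (redactedLaw n k hk (iseq t)).toMeasure)
      = Measure.pi (fun t : Fin Q => (redactedLaw n k hk (jseq t)).toMeasure) ∧
    Measure.pi (fun t : Fin Q => (redactedLaw n k hk (iseq t)).toMeasure)
      = Measure.pi (fun _ : Fin Q =>
          (PMF.uniformOfFinset (multisetsCard n (k - 1))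
            (multisetsCard_nonempty n (k - 1) hn)).toMeasure) := by
  simp only [redactedLaw_eq' n k hn hk, and_self]
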